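/- For any finite index set I ⊆ {1,…,r}, complex parameter d ≠ 0, and complex numbers x₁,…,x_r such that all denominators below are nonzero, one has ∑_{i∈I} (x_i + 1 + (d/2)(r−i)) · A⁻_{i,I∖{i}}(x+ε_i) · A⁺_{i,I∖{i}}(x) − ∑_{i∈I} (x_i + (d/2)(r−i)) · A⁺_{i,I∖{i}}(x−ε_i) · A⁻_{i,I∖{i}}(x) = |I|, where A^{±}_{i,J}(x) := ∏_{j∈J} (x_i − x_j − (d/2)(i−j) ± d/2) / (x_i − x_j − (d/2)(i−j)) and ε_i denotes the i-th standard basis vector. -/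

import Mathlib

open Polynomial in
lemma tp_T (y : ℕ → ℂ) (t : ℂ) (I : Finset ℕ) :
    (∏ j ∈ I, ((X - C (y j)) * (X - C (y j + 1)) + C t)).natDegree ≤ 2 * I.card ∧
    (∏ j ∈ I, ((X - C (y j)) * (X - C (y j + 1)) + C t)).coeff (2 * I.card) = 1 ∧
    (X ^ 2 * ((∏ j ∈ I, ((X - C (y j)) * (X - C (y j + 1)) + C t))
      - ∏ j ∈ I, ((X - C (y j)) * (X - C (y j + 1))))).natDegree ≤ 2 * I.card ∧
    (X ^ 2 * ((∏ j ∈ I, ((X - C (y j)) * (X - C (y j + 1)) + C t))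
      - ∏ j ∈ I, ((X - C (y j)) * (X - C (y j + 1))))).coeff (2 * I.card) = I.card * t := by
  induction I using Finset.induction_on with
  | empty => simp
  | insert a I ha ih =>
    obtain ⟨h1, h2, h3, h4⟩ := ih
    rw [Finset.prod_insert ha, Finset.prod_insert ha, Finset.card_insert_of_notMem ha]
    set P := ∏ j ∈ I, ((X - C (y j)) * (X - C (y j + 1)) + C t)
    set Q := ∏ j ∈ I, ((X - C (y j)) * (X - C (y j + 1)))
    have e : X ^ 2 * (((X - C (y a)) * (X - C (y a + 1)) + C t) * P
        - (X - C (y a)) * (X - C (y a + 1)) * Q)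
        = ((X - C (y a)) * (X - C (y a + 1))) * (X ^ 2 * (P - Q)) + (C t * X ^ 2) * P := by ring
    have hn : 2 * (I.card + 1) = 2 + 2 * I.card := by ring
    have d1 : ((X - C (y a)) * (X - C (y a + 1)) + C t).natDegree ≤ 2 := by compute_degree
    have d2 : ((X - C (y a)) * (X - C (y a + 1))).natDegree ≤ 2 := by compute_degree
    have d3 : (C t * X ^ 2 : ℂ[X]).natDegree ≤ 2 := by compute_degree
    have c1 : ((X - C (y a)) * (X - C (y a + 1)) + C t).coeff 2 = 1 := by compute_degree!
    have c2 : ((X - C (y a)) * (X - C (y a + 1))).coeff 2 = 1 := by compute_degree!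
    have c3 : (C t * X ^ 2 : ℂ[X]).coeff 2 = t := by simp
    rw [e, hn]
    refine ⟨natDegree_mul_le_of_le d1 h1, ?_, ?_, ?_⟩
    · rw [coeff_mul_add_eq_of_natDegree_le d1 h1, c1, h2, one_mul]
    · exact natDegree_add_le_of_degree_le (natDegree_mul_le_of_le d2 h3)
        (natDegree_mul_le_of_le d3 h1)
    · rw [coeff_add, coeff_mul_add_eq_of_natDegree_le d2 h3,
        coeff_mul_add_eq_of_natDegree_le d3 h1, c2, c3, h2, h4]
      push_cast; ring

open Polynomial in
lemma tp_main (y : ℕ → ℂ) (t : ℂ) (I : Finset ℕ)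
    (h : ∀ i ∈ I, ∀ j ∈ I, i ≠ j → y i - y j ≠ 0 ∧ y i + 1 - y j ≠ 0 ∧ y i - 1 - y j ≠ 0) :
    (∑ i ∈ I, (y i + 1) * ∏ j ∈ I.erase i,
        (((y i + 1 - y j) * (y i - y j) + t) / ((y i + 1 - y j) * (y i - y j))))
    - (∑ i ∈ I, y i * ∏ j ∈ I.erase i,
        (((y i - y j) * (y i - 1 - y j) + t) / ((y i - y j) * (y i - 1 - y j))))
    = (I.card : ℂ) := by
  rcases eq_or_ne t 0 with rfl | ht
  · have e1 : ∀ i ∈ I, (y i + 1) * ∏ j ∈ I.erase i,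
        (((y i + 1 - y j) * (y i - y j) + 0) / ((y i + 1 - y j) * (y i - y j))) = y i + 1 := by
      intro i hi
      rw [Finset.prod_eq_one, mul_one]
      intro j hj
      obtain ⟨hne, hj⟩ := Finset.mem_erase.1 hj
      obtain ⟨a, b, c⟩ := h i hi j hj hne.symm
      rw [add_zero, div_self (mul_ne_zero b a)]
    have e2 : ∀ i ∈ I, y i * ∏ j ∈ I.erase i,
        (((y i - y j) * (y i - 1 - y j) + 0) / ((y i - y j) * (y i - 1 - y j))) = y i := by
      intro i hi
      rw [Finset.prod_eq_one, mul_one]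
      intro j hj
      obtain ⟨hne, hj⟩ := Finset.mem_erase.1 hj
      obtain ⟨a, b, c⟩ := h i hi j hj hne.symm
      rw [add_zero, div_self (mul_ne_zero a c)]
    rw [Finset.sum_congr rfl e1, Finset.sum_congr rfl e2, Finset.sum_add_distrib]
    simp
  rcases I.eq_empty_or_nonempty with rfl | hne
  · simp
  have hpos : 0 < I.card := hne.card_pos
  obtain ⟨-, -, h3, h4⟩ := tp_T y t I
  set R : ℂ[X] := (∏ j ∈ I, ((X - C (y j)) * (X - C (y j + 1)) + C t))
      - ∏ j ∈ I, ((X - C (y j)) * (X - C (y j + 1))) with hR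
  set v : ℕ ⊕ ℕ → ℂ := Sum.elim y (fun j => y j + 1) with hv
  have hcard : (I.disjSum I).card = 2 * I.card := by rw [Finset.card_disjSum]; ring
  have hvs : Set.InjOn v (I.disjSum I : Finset (ℕ ⊕ ℕ)) := by
    rintro (i | i) hi (j | j) hj hij <;>
      simp only [Finset.mem_coe, Finset.inl_mem_disjSum,
        Finset.inr_mem_disjSum, Finset.mem_disjSum, hv, Sum.elim_inl, Sum.elim_inr] at hi hj hij
    · by_contra hc
      exact (h i (by simpa using hi) j (by simpa using hj) (fun e => hc (by rw [e]))).1 (by rw [hij]; ring)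
    · by_cases hc : i = j
      · subst hc; simp at hij
      · exact absurd (by rw [hij]; ring) (h i (by simpa using hi) j (by simpa using hj) hc).2.2
    · by_cases hc : i = j
      · subst hc; simp at hij
      · exact absurd (by rw [hij]; ring) (h i (by simpa using hi) j (by simpa using hj) hc).2.1
    · by_contra hc
      exact (h i (by simpa using hi) j (by simpa using hj) (fun e => hc (by rw [e]))).1
        (by linear_combination hij)
  have hXX : X ^ 2 * R = (X * R) * X := by ring
  have hdeg : (X * R).degree < (((I.disjSum I).card : ℕ) : WithBot ℕ) := by
    rw [hcard, degree_lt_iff_coeff_zero]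
    intro m hm
    rw [← coeff_mul_X, ← hXX]
    exact coeff_eq_zero_of_natDegree_lt (by omega)
  have key := Lagrange.coeff_eq_sum hvs hdeg
  have hco : (X * R).coeff ((I.disjSum I).card - 1) = I.card * t := by
    rw [← h4, hXX, hcard]
    obtain ⟨m, hm⟩ : ∃ m, 2 * I.card = m + 1 := ⟨2 * I.card - 1, by omega⟩
    rw [hm, coeff_mul_X]; rfl
  rw [hco, Finset.sum_disjSum] at key
  have er1 : ∀ i, (I.disjSum I).erase (Sum.inl i) = (I.erase i).disjSum I := by
    intro i; ext (j | j) <;> simp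
  have er2 : ∀ i, (I.disjSum I).erase (Sum.inr i) = I.disjSum (I.erase i) := by
    intro i; ext (j | j) <;> simp
  have t1 : ∀ i ∈ I, (X * R).eval (v (Sum.inl i)) /
      ∏ j ∈ (I.disjSum I).erase (Sum.inl i), (v (Sum.inl i) - v j)
      = - t * (y i * ∏ j ∈ I.erase i,
        (((y i - y j) * (y i - 1 - y j) + t) / ((y i - y j) * (y i - 1 - y j)))) := by
    intro i hi
    have z : ∏ j ∈ I, ((y i - y j) * (y i - (y j + 1))) = 0 :=
      Finset.prod_eq_zero hi (by simp)
    rw [er1, Finset.prod_disjSum, hR, Finset.prod_div_distrib]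
    simp only [hv, Sum.elim_inl, Sum.elim_inr, eval_mul, eval_X, eval_sub, eval_prod, eval_add,
      eval_C, z]
    rw [← Finset.mul_prod_erase I _ hi, ← Finset.mul_prod_erase I (fun j => y i - (y j + 1)) hi]
    have q : ∀ j, y i - (y j + 1) = y i - 1 - y j := fun j => by ring
    simp only [q]
    have : y i - 1 - y i = -1 := by ring
    rw [this, sub_self, zero_mul, zero_add, sub_zero, Finset.prod_mul_distrib]
    simp only [div_eq_mul_inv, mul_inv]
    norm_num
    ring
  have t2 : ∀ i ∈ I, (X * R).eval (v (Sum.inr i)) /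
      ∏ j ∈ (I.disjSum I).erase (Sum.inr i), (v (Sum.inr i) - v j)
      = t * ((y i + 1) * ∏ j ∈ I.erase i,
        (((y i + 1 - y j) * (y i - y j) + t) / ((y i + 1 - y j) * (y i - y j)))) := by
    intro i hi
    have z : ∏ j ∈ I, ((y i + 1 - y j) * (y i + 1 - (y j + 1))) = 0 :=
      Finset.prod_eq_zero hi (by simp)
    rw [er2, Finset.prod_disjSum, hR, Finset.prod_div_distrib]
    simp only [hv, Sum.elim_inl, Sum.elim_inr, eval_mul, eval_X, eval_sub, eval_prod, eval_add,
      eval_C, z]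
    rw [← Finset.mul_prod_erase I _ hi, ← Finset.mul_prod_erase I (fun j => y i + 1 - y j) hi]
    have q : ∀ j, y i + 1 - (y j + 1) = y i - y j := fun j => by ring
    simp only [q]
    have : y i + 1 - y i = 1 := by ring
    rw [this, sub_self, mul_zero, zero_add, sub_zero, Finset.prod_mul_distrib]
    simp only [div_eq_mul_inv, mul_inv]
    norm_num
    ring
  rw [Finset.sum_congr rfl t1, Finset.sum_congr rfl t2, ← Finset.mul_sum, ← Finset.mul_sum] at key
  apply mul_left_cancel₀ ht
  linear_combination -key

/-- Lemma 2.1 of Shibukawa: the key rational-function summation identity. -/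
theorem twisted_pieri_key_sum (r : ℕ) (d : ℂ) (hd : d ≠ 0)
    (I : Finset ℕ) (hI : I ⊆ Finset.Icc 1 r) (x : ℕ → ℂ)
    (hden : ∀ i ∈ I, ∀ j ∈ I, i ≠ j →
      x i - x j - d / 2 * ((i : ℂ) - (j : ℂ)) ≠ 0 ∧
      x i + 1 - x j - d / 2 * ((i : ℂ) - (j : ℂ)) ≠ 0 ∧
      x i - 1 - x j - d / 2 * ((i : ℂ) - (j : ℂ)) ≠ 0) :
    (∑ i ∈ I, (x i + 1 + d / 2 * ((r : ℂ) - (i : ℂ)))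
        * (∏ j ∈ I.erase i,
            (x i + 1 - x j - d / 2 * ((i : ℂ) - (j : ℂ)) - d / 2) /
            (x i + 1 - x j - d / 2 * ((i : ℂ) - (j : ℂ))))
        * (∏ j ∈ I.erase i,
            (x i - x j - d / 2 * ((i : ℂ) - (j : ℂ)) + d / 2) /
            (x i - x j - d / 2 * ((i : ℂ) - (j : ℂ)))))
    - (∑ i ∈ I, (x i + d / 2 * ((r : ℂ) - (i : ℂ)))
        * (∏ j ∈ I.erase i,
            (x i - 1 - x j - d / 2 * ((i : ℂ) - (j : ℂ)) + d / 2) /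
            (x i - 1 - x j - d / 2 * ((i : ℂ) - (j : ℂ))))
        * (∏ j ∈ I.erase i,
            (x i - x j - d / 2 * ((i : ℂ) - (j : ℂ)) - d / 2) /
            (x i - x j - d / 2 * ((i : ℂ) - (j : ℂ)))))
    = (I.card : ℂ) := by
  have hy : ∀ i j : ℕ, x i - x j - d / 2 * ((i : ℂ) - (j : ℂ))
      = (x i + d / 2 * ((r : ℂ) - i)) - (x j + d / 2 * ((r : ℂ) - j)) := fun i j => by ring
  have hy1 : ∀ i j : ℕ, x i + 1 - x j - d / 2 * ((i : ℂ) - (j : ℂ))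
      = (x i + d / 2 * ((r : ℂ) - i)) + 1 - (x j + d / 2 * ((r : ℂ) - j)) := fun i j => by ring
  have hy2 : ∀ i j : ℕ, x i - 1 - x j - d / 2 * ((i : ℂ) - (j : ℂ))
      = (x i + d / 2 * ((r : ℂ) - i)) - 1 - (x j + d / 2 * ((r : ℂ) - j)) := fun i j => by ring
  have hy3 : ∀ i : ℕ, x i + 1 + d / 2 * ((r : ℂ) - (i : ℂ))
      = (x i + d / 2 * ((r : ℂ) - i)) + 1 := fun i => by ring
  simp only [hy, hy1, hy2] at hden
  have key := tp_main (fun i => x i + d / 2 * ((r : ℂ) - i)) (d / 2 * (1 - d / 2)) I hden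
  simp only [hy, hy1, hy2, hy3]
  rw [← key]
  congr 1
  · refine Finset.sum_congr rfl fun i _ => ?_
    rw [mul_assoc, ← Finset.prod_mul_distrib]
    congr 1
    refine Finset.prod_congr rfl fun j _ => ?_
    rw [div_mul_div_comm]
    congr 1
    ring
  · refine Finset.sum_congr rfl fun i _ => ?_
    rw [mul_assoc, ← Finset.prod_mul_distrib]
    congr 1
    refine Finset.prod_congr rfl fun j _ => ?_
    rw [div_mul_div_comm, mul_comm (_ - 1 - _)]
    congr 1 <;> ring
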